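/- Let P be a finite set containing a distinguished vertex v₀ with |P| ≥ 2, with positive weights ω_v > 0 for v ∈ P∖{v₀}. Let I and S be finite index sets, where each e ∈ I carries a real c_e > 0 and a nonempty subset I_e ⊆ P, and each e ∈ S carries a real c_e > 0 and a nonempty subset S_e ⊆ P. For nonempty X ⊆ P∖{v₀} define δ(X) := (Σ_{e∈I : I_e⊆X} c_e − Σ_{e∈S : S_e∩X≠∅} c_e)/ω(X) and δ̃(X) := (Σ_{e∈I : I_e∩X≠∅} c_e − Σ_{e∈S : S_e⊆X} c_e)/ω(X), where ω(X) := Σ_{v∈X} ω_v. Suppose that δ(X) ≤ 0 and δ̃(X) ≥ 0 for every nonempty X ⊆ P∖{v₀}. Then there exist nonnegative reals x_v(e) for each e ∈ I and v ∈ I_e, and nonnegative reals y_v(e) for each e ∈ S and v ∈ S_e, such that Σ_{v∈I_e} x_v(e) = c_e for every e ∈ I, Σ_{v∈S_e} y_v(e) = c_e for every e ∈ S, and every v ∈ P∖{v₀} has zero net rate: Σ_{e∈I : v∈I_e} x_v(e) − Σ_{e∈S : v∈S_e} y_v(e) = 0. -/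

import Mathlib

open Finset
open scoped Classical

noncomputable section

/-- A weighted sum of nonnegative reals is nonpositive if the total weight of every superlevel set
at a positive level is nonpositive. -/
theorem sum_mul_nonpos_of_superlevel {J : Type*} [Fintype J] (w r : J → ℝ) (hr : ∀ j, 0 ≤ r j)
    (h : ∀ t, 0 < t → ∑ j, (if t ≤ r j then w j else 0) ≤ 0) : ∑ j, w j * r j ≤ 0 := by
  induction hn : #{j | 0 < r j} using Nat.strong_induction_on generalizing r with
  | _ n ih =>
    subst hn
    rcases ({j | 0 < r j} : Finset J).eq_empty_or_nonempty with he | hne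
    · refine Finset.sum_nonpos fun j _ => ?_
      have hj : ¬ 0 < r j := fun hj => by
        exact Finset.filter_eq_empty_iff.1 he (Finset.mem_univ j) hj
      rw [le_antisymm (not_lt.1 hj) (hr j), mul_zero]
    · obtain ⟨k, hk, hmin⟩ := Finset.exists_min_image _ r hne
      simp only [Finset.mem_filter, Finset.mem_univ, true_and] at hk hmin
      have key : ∑ j, w j * max (r j - r k) 0 ≤ 0 := by
        refine ih _ ?_ _ (fun j => le_max_right _ _) ?_ rfl
        · refine Finset.card_lt_card (Finset.ssubset_iff_of_subset ?_ |>.2 ⟨k, ?_, ?_⟩)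
          · intro j
            simp only [Finset.mem_filter, Finset.mem_univ, true_and, lt_max_iff, lt_irrefl, or_false]
            intro hj
            linarith
          · simpa using hk
          · simp
        · intro t ht
          refine (Finset.sum_congr rfl fun j _ => if_congr ?_ rfl rfl).trans_le
            (h (t + r k) (by linarith))
          rw [le_max_iff, le_sub_iff_add_le, or_iff_left (not_le.2 ht)]
      have split : ∀ j, w j * r j
          = w j * max (r j - r k) 0 + r k * (if r k ≤ r j then w j else 0) := by
        intro j
        by_cases hj : 0 < r j
        · rw [if_pos (hmin j hj), max_eq_left (by linarith [hmin j hj])]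
          ring
        · have h0 : r j = 0 := le_antisymm (not_lt.1 hj) (hr j)
          rw [if_neg (by linarith), max_eq_right (by linarith), h0]
          ring
      simp only [split, Finset.sum_add_distrib, ← Finset.mul_sum]
      have := mul_nonpos_of_nonneg_of_nonpos hk.le (h _ hk)
      linarith

/-- If the sets contained in any `X ∌ v₀` weigh at most as much as the sets meeting `X`, then the
weighted minima of a nonnegative potential vanishing at `v₀` are at most its weighted maxima. -/
theorem sum_min_le_sum_max {P I S : Type*} [Fintype P] [DecidableEq P] [Fintype I] [Fintype S]
    (v₀ : P) (cI : I → ℝ) (Ie : I → Finset P) (cS : S → ℝ) (Se : S → Finset P)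
    (h : ∀ X : Finset P, v₀ ∉ X → ∑ e, (if Ie e ⊆ X then cI e else 0)
      ≤ ∑ e, (if (Se e ∩ X).Nonempty then cS e else 0))
    (p : P → ℝ) (hp : ∀ v, 0 ≤ p v) (hp₀ : p v₀ = 0)
    (a : I → P) (ha : ∀ e, a e ∈ Ie e) (hamin : ∀ e, ∀ v ∈ Ie e, p (a e) ≤ p v)
    (b : S → P) (hb : ∀ e, b e ∈ Se e) (hbmax : ∀ e, ∀ v ∈ Se e, p v ≤ p (b e)) :
    ∑ e, cI e * p (a e) ≤ ∑ e, cS e * p (b e) := by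
  have key := sum_mul_nonpos_of_superlevel (Sum.elim cI fun e => -cS e)
    (Sum.elim (fun e => p (a e)) fun e => p (b e)) (by rintro (e | e) <;> exact hp _) ?_
  · simp only [Fintype.sum_sum_type, Sum.elim_inl, Sum.elim_inr, neg_mul,
      Finset.sum_neg_distrib] at key
    linarith
  · intro t ht
    have hX := h {v | t ≤ p v} (by simp [hp₀, ht])
    have hI : ∀ e, Ie e ⊆ ({v | t ≤ p v} : Finset P) ↔ t ≤ p (a e) := fun e =>
      ⟨fun hs => (Finset.mem_filter.1 (hs (ha e))).2, fun hs v hv =>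
        Finset.mem_filter.2 ⟨Finset.mem_univ v, hs.trans (hamin e v hv)⟩⟩
    have hS : ∀ e, (Se e ∩ ({v | t ≤ p v} : Finset P)).Nonempty ↔ t ≤ p (b e) := by
      refine fun e => ⟨?_, fun hs => ⟨b e, by simp [hb e, hs]⟩⟩
      rintro ⟨v, hv⟩
      simp only [Finset.mem_inter, Finset.mem_filter, Finset.mem_univ, true_and] at hv
      exact hv.2.trans (hbmax e v hv.1)
    rw [Finset.sum_congr rfl fun e _ => if_congr (hI e) rfl rfl,
      Finset.sum_congr rfl fun e _ => if_congr (hS e) rfl rfl] at hX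
    rw [Fintype.sum_sum_type]
    change ∑ e, (if t ≤ p (a e) then cI e else 0) + ∑ e, (if t ≤ p (b e) then -cS e else 0) ≤ 0
    have hneg : ∀ e, (if t ≤ p (b e) then -cS e else 0) = -(if t ≤ p (b e) then cS e else 0) :=
      fun e => by split_ifs <;> simp
    simp only [hneg, Finset.sum_neg_distrib]
    linarith

/-- The net measure rates, with vertices embedded by `d`, of all allocations of the supply rates
`cI` to the sets `Ie` and of the demand rates `cS` to the sets `Se`. -/
def netRates {P I S E : Type*} [Fintype I] [Fintype S] [AddCommGroup E] [Module ℝ E] (d : P → E)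
    (cI : I → ℝ) (Ie : I → Finset P) (cS : S → ℝ) (Se : S → Finset P) : Set E :=
  {z | ∃ (x : I → P → ℝ) (y : S → P → ℝ), (∀ e v, 0 ≤ x e v) ∧ (∀ e v, 0 ≤ y e v) ∧
    (∀ e, ∑ v ∈ Ie e, x e v = cI e) ∧ (∀ e, ∑ v ∈ Se e, y e v = cS e) ∧
    z = ∑ e, ∑ v ∈ Ie e, x e v • d v - ∑ e, ∑ v ∈ Se e, y e v • d v}

theorem convex_netRates {P I S E : Type*} [Fintype I] [Fintype S] [AddCommGroup E] [Module ℝ E]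
    (d : P → E) (cI : I → ℝ) (Ie : I → Finset P) (cS : S → ℝ) (Se : S → Finset P) :
    Convex ℝ (netRates d cI Ie cS Se) := by
  rintro _ ⟨x, y, hx, hy, hxc, hyc, rfl⟩ _ ⟨x', y', hx', hy', hxc', hyc', rfl⟩ s t hs ht hst
  refine ⟨fun e v => s * x e v + t * x' e v, fun e v => s * y e v + t * y' e v,
    fun e v => add_nonneg (mul_nonneg hs (hx e v)) (mul_nonneg ht (hx' e v)),
    fun e v => add_nonneg (mul_nonneg hs (hy e v)) (mul_nonneg ht (hy' e v)), ?_, ?_, ?_⟩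
  · intro e
    rw [Finset.sum_add_distrib, ← Finset.mul_sum, ← Finset.mul_sum, hxc, hxc', ← add_mul, hst,
      one_mul]
  · intro e
    rw [Finset.sum_add_distrib, ← Finset.mul_sum, ← Finset.mul_sum, hyc, hyc', ← add_mul, hst,
      one_mul]
  · simp only [add_smul, mul_smul, Finset.sum_add_distrib, ← Finset.smul_sum]
    module

theorem vertex_mem_netRates {P I S E : Type*} [DecidableEq P] [Fintype I] [Fintype S]
    [AddCommGroup E] [Module ℝ E] (d : P → E)
    (cI : I → ℝ) (hcI : ∀ e, 0 ≤ cI e) (Ie : I → Finset P)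
    (cS : S → ℝ) (hcS : ∀ e, 0 ≤ cS e) (Se : S → Finset P)
    (a : I → P) (ha : ∀ e, a e ∈ Ie e) (b : S → P) (hb : ∀ e, b e ∈ Se e) :
    ∑ e, cI e • d (a e) - ∑ e, cS e • d (b e) ∈ netRates d cI Ie cS Se := by
  refine ⟨fun e v => if v = a e then cI e else 0, fun e v => if v = b e then cS e else 0,
    ?_, ?_, ?_, ?_, ?_⟩
  · intro e v
    dsimp only
    split_ifs
    exacts [hcI e, le_rfl]
  · intro e v
    dsimp only
    split_ifs
    exacts [hcS e, le_rfl]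
  · simp [ha]
  · simp [hb]
  · simp [ite_smul, ha, hb]

/-- If no potential makes all extreme allocations have positive net value, then some allocation has
zero net rate. -/
theorem zero_mem_netRates {P I S E : Type*} [Fintype P] [DecidableEq P] [Fintype I] [Fintype S]
    [NormedAddCommGroup E] [NormedSpace ℝ E] (d : P → E)
    (cI : I → ℝ) (hcI : ∀ e, 0 ≤ cI e) (Ie : I → Finset P)
    (cS : S → ℝ) (hcS : ∀ e, 0 ≤ cS e) (Se : S → Finset P)
    (h : ∀ f : E →L[ℝ] ℝ, ∃ (a : I → P) (b : S → P), (∀ e, a e ∈ Ie e) ∧ (∀ e, b e ∈ Se e) ∧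
      ∑ e, cI e * f (d (a e)) ≤ ∑ e, cS e * f (d (b e))) :
    (0 : E) ∈ netRates d cI Ie cS Se := by
  let g : {ab : (I → P) × (S → P) // (∀ e, ab.1 e ∈ Ie e) ∧ ∀ e, ab.2 e ∈ Se e} → E :=
    fun ab => ∑ e, cI e • d (ab.1.1 e) - ∑ e, cS e • d (ab.1.2 e)
  have hsub : convexHull ℝ (Set.range g) ⊆ netRates d cI Ie cS Se := by
    refine convexHull_min ?_ (convex_netRates d cI Ie cS Se)
    rintro _ ⟨⟨ab, ha, hb⟩, rfl⟩
    exact vertex_mem_netRates d cI hcI Ie cS hcS Se ab.1 ha ab.2 hb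
  refine hsub ?_
  by_contra h0
  obtain ⟨f, u, hu, hf⟩ := geometric_hahn_banach_point_closed (convex_convexHull ℝ _)
    ((Set.finite_range g).isClosed_convexHull ℝ) h0
  obtain ⟨a, b, ha, hb, hab⟩ := h f
  have hpos := hf _ (subset_convexHull ℝ _ ⟨⟨(a, b), ha, hb⟩, rfl⟩)
  simp only [g, map_sub, map_sum, map_smul, smul_eq_mul, map_zero] at hpos hu
  linarith

/-- existence of a feasible measure-rate allocation in the
presence of a stationary vertex `v₀`, when every nonempty subset of `P ∖ {v₀}`
has density `δ(X) ≤ 0` and co-density `δ̃(X) ≥ 0`; every non-stationary vertex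
then has zero net rate. -/
theorem exists_allocation_with_stationary_vertex
    (P I S : Type) [Fintype P] [DecidableEq P] [Fintype I] [Fintype S]
    (v₀ : P) (hcard : 2 ≤ Fintype.card P)
    (ω : P → ℝ) (hω : ∀ v, v ≠ v₀ → 0 < ω v)
    (cI : I → ℝ) (hcI : ∀ e, 0 < cI e) (Ie : I → Finset P) (hIe : ∀ e, (Ie e).Nonempty)
    (cS : S → ℝ) (hcS : ∀ e, 0 < cS e) (Se : S → Finset P) (hSe : ∀ e, (Se e).Nonempty)
    (hδ : ∀ X : Finset P, X.Nonempty → X ⊆ Finset.univ.erase v₀ →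
      ((∑ e ∈ Finset.univ.filter (fun e : I => Ie e ⊆ X), cI e)
          - ∑ e ∈ Finset.univ.filter (fun e : S => (Se e ∩ X).Nonempty), cS e)
        / (∑ v ∈ X, ω v) ≤ 0)
    (hδt : ∀ X : Finset P, X.Nonempty → X ⊆ Finset.univ.erase v₀ →
      0 ≤ ((∑ e ∈ Finset.univ.filter (fun e : I => (Ie e ∩ X).Nonempty), cI e)
          - ∑ e ∈ Finset.univ.filter (fun e : S => Se e ⊆ X), cS e)
        / (∑ v ∈ X, ω v)) :
    ∃ (x : I → P → ℝ) (y : S → P → ℝ),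
      (∀ e v, 0 ≤ x e v) ∧ (∀ e v, 0 ≤ y e v) ∧
      (∀ e : I, ∑ v ∈ Ie e, x e v = cI e) ∧
      (∀ e : S, ∑ v ∈ Se e, y e v = cS e) ∧
      (∀ v : P, v ≠ v₀ →
        (∑ e ∈ Finset.univ.filter (fun e : I => v ∈ Ie e), x e v)
          - (∑ e ∈ Finset.univ.filter (fun e : S => v ∈ Se e), y e v) = 0) := by
  have hω' : ∀ X : Finset P, X.Nonempty → v₀ ∉ X → 0 < ∑ v ∈ X, ω v := fun X hX h₀ =>
    Finset.sum_pos (fun v hv => hω v (ne_of_mem_of_not_mem hv h₀)) hX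
  have hsub : ∀ X : Finset P, v₀ ∉ X → X ⊆ Finset.univ.erase v₀ := fun X h₀ =>
    Finset.subset_erase.2 ⟨Finset.subset_univ X, h₀⟩
  have hsupply : ∀ X : Finset P, v₀ ∉ X → ∑ e, (if Ie e ⊆ X then cI e else 0)
      ≤ ∑ e, (if (Se e ∩ X).Nonempty then cS e else 0) := by
    intro X h₀
    rcases X.eq_empty_or_nonempty with rfl | hX
    · simp [Finset.subset_empty, (hIe _).ne_empty]
    · have := (div_le_iff₀ (hω' X hX h₀)).1 (hδ X hX (hsub X h₀))
      rw [Finset.sum_filter, Finset.sum_filter] at this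
      linarith
  have hdemand : ∀ X : Finset P, v₀ ∉ X → ∑ e, (if Se e ⊆ X then cS e else 0)
      ≤ ∑ e, (if (Ie e ∩ X).Nonempty then cI e else 0) := by
    intro X h₀
    rcases X.eq_empty_or_nonempty with rfl | hX
    · simp [Finset.subset_empty, (hSe _).ne_empty]
    · have := (le_div_iff₀ (hω' X hX h₀)).1 (hδt X hX (hsub X h₀))
      rw [Finset.sum_filter, Finset.sum_filter] at this
      linarith
  let d : P → P → ℝ := fun v => if v = v₀ then 0 else Pi.single v 1
  obtain ⟨x, y, hx, hy, hxc, hyc, hz⟩ := zero_mem_netRates d cI (fun e => (hcI e).le) Ie cS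
    (fun e => (hcS e).le) Se (by
      intro f
      choose a ha hamin using fun e => Finset.exists_min_image (Ie e) (fun v => f (d v)) (hIe e)
      choose b hb hbmax using fun e => Finset.exists_max_image (Se e) (fun v => f (d v)) (hSe e)
      refine ⟨a, b, ha, hb, ?_⟩
      have h₀ : f (d v₀) = 0 := by simp [d]
      have hp := sum_min_le_sum_max v₀ cI Ie cS Se hsupply (fun v => (f (d v))⁺)
        (fun v => posPart_nonneg _) (by simp [h₀])
        a ha (fun e v hv => posPart_mono (hamin e v hv))
        b hb (fun e v hv => posPart_mono (hbmax e v hv))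
      have hn := sum_min_le_sum_max v₀ cS Se cI Ie hdemand (fun v => (f (d v))⁻)
        (fun v => negPart_nonneg _) (by simp [h₀])
        b hb (fun e v hv => negPart_anti (hbmax e v hv))
        a ha (fun e v hv => negPart_anti (hamin e v hv))
      have hsplit : ∀ v, f (d v) = (f (d v))⁺ - (f (d v))⁻ := fun v =>
        (posPart_sub_negPart _).symm
      calc ∑ e, cI e * f (d (a e))
          = ∑ e, cI e * (f (d (a e)))⁺ - ∑ e, cI e * (f (d (a e)))⁻ := by
            rw [← Finset.sum_sub_distrib]
            exact Finset.sum_congr rfl fun e _ => by rw [← mul_sub, ← hsplit]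
        _ ≤ ∑ e, cS e * (f (d (b e)))⁺ - ∑ e, cS e * (f (d (b e)))⁻ := by
            linarith
        _ = ∑ e, cS e * f (d (b e)) := by
            rw [← Finset.sum_sub_distrib]
            exact Finset.sum_congr rfl fun e _ => by rw [← mul_sub, ← hsplit])
  refine ⟨x, y, hx, hy, hxc, hyc, fun v hv => ?_⟩
  have hd : ∀ u, d u v = if u = v then 1 else 0 := by
    intro u
    by_cases hu : u = v₀
    · simp [d, hu, hv.symm]
    · simp only [d, if_neg hu, Pi.single_apply, eq_comm (a := v)]
  have hzv := congrFun hz v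
  simp only [Pi.zero_apply, Pi.sub_apply, Finset.sum_apply, Pi.smul_apply, smul_eq_mul, hd,
    mul_ite, mul_one, mul_zero, Finset.sum_ite_eq'] at hzv
  rw [Finset.sum_filter, Finset.sum_filter]
  exact hzv.symm
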